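/- Discrete LBB (inf-sup) condition for the MAC-E scheme with constant β = 1: for every pair of discrete functions v^x (defined at (x_i, y_{j+1/2}), 1 ≤ i ≤ n_x−1, 0 ≤ j ≤ n_y−1) and v^y (defined at (x_{i+1/2}, y_j), 0 ≤ i ≤ n_x−1, 1 ≤ j ≤ n_y−1), not both identically zero, there exist discrete functions τ^{11}, τ^{22} defined at the cell centers (x_{i+1/2}, y_{j+1/2}) and τ^{12} defined at the grid nodes (x_i, y_j), not all identically zero, such that (D_x τ^{11} + d_y τ^{12}, v^x)_{TM} + (d_x τ^{12} + D_y τ^{22}, v^y)_{MT} ≥ (‖τ^{11}‖_M² + ‖τ^{22}‖_M² + ‖τ^{12}‖_T²)^{1/2} · (‖v^x‖_{TM}² + ‖v^y‖_{MT}²)^{1/2}. -/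

import Mathlib

open Finset

noncomputable section

/-- The midpoint `x_{i+1/2} = (x_i + x_{i+1})/2`. -/
def midpt (x : ℕ → ℝ) (i : ℕ) : ℝ := (x i + x (i + 1)) / 2

/-- The cell width `h_{i+1/2} = x_{i+1} - x_i`. -/
def hMid (x : ℕ → ℝ) (i : ℕ) : ℝ := x (i + 1) - x i

/-- `h_i = x_{i+1/2} - x_{i-1/2}` for `1 ≤ i ≤ n-1`, together with the boundary
conventions `h_0 = h_{1/2}/2` and `h_n = h_{n-1/2}/2`. -/
def hNode (x : ℕ → ℝ) (n i : ℕ) : ℝ :=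
  if i = 0 then hMid x 0 / 2
  else if i = n then hMid x (n - 1) / 2
  else midpt x i - midpt x (i - 1)

/-- `0 = x_0 < x_1 < ⋯ < x_n = 1`. -/
def IsGrid (x : ℕ → ℝ) (n : ℕ) : Prop :=
  x 0 = 0 ∧ x n = 1 ∧ ∀ i < n, x i < x (i + 1)

/-- Discrete inner product `(φ,θ)_M` over the cell centers `(x_{i+1/2}, y_{j+1/2})`. -/
def ipM (x y : ℕ → ℝ) (nx ny : ℕ) (φ θ : ℕ → ℕ → ℝ) : ℝ :=
  ∑ i ∈ range nx, ∑ j ∈ range ny, hMid x i * hMid y j * φ i j * θ i j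

/-- Discrete inner product `(φ,θ)_T` over the grid nodes `(x_i, y_j)`. -/
def ipT (x y : ℕ → ℝ) (nx ny : ℕ) (φ θ : ℕ → ℕ → ℝ) : ℝ :=
  ∑ i ∈ range (nx + 1), ∑ j ∈ range (ny + 1), hNode x nx i * hNode y ny j * φ i j * θ i j

/-- Discrete inner product `(φ,θ)_{TM}` over the points `(x_i, y_{j+1/2})`,
`1 ≤ i ≤ n_x - 1`, `0 ≤ j ≤ n_y - 1`. -/
def ipTM (x y : ℕ → ℝ) (nx ny : ℕ) (φ θ : ℕ → ℕ → ℝ) : ℝ :=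
  ∑ i ∈ Ico 1 nx, ∑ j ∈ range ny, hNode x nx i * hMid y j * φ i j * θ i j

/-- Discrete inner product `(φ,θ)_{MT}` over the points `(x_{i+1/2}, y_j)`,
`0 ≤ i ≤ n_x - 1`, `1 ≤ j ≤ n_y - 1`. -/
def ipMT (x y : ℕ → ℝ) (nx ny : ℕ) (φ θ : ℕ → ℕ → ℝ) : ℝ :=
  ∑ i ∈ range nx, ∑ j ∈ Ico 1 ny, hMid x i * hNode y ny j * φ i j * θ i j

/-- The values `v_1, …, v_{n-1}` extended by zero to the boundary indices `0` and `n`. -/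
def zeroExt (n : ℕ) (v : ℕ → ℝ) (i : ℕ) : ℝ := if i = 0 ∨ i = n then 0 else v i

/-- The negative difference quotient `-[d_x v]_{i+1/2}` of the zero extension of `v`. -/
def negDiff (x : ℕ → ℝ) (n : ℕ) (v : ℕ → ℝ) (i : ℕ) : ℝ :=
  -((zeroExt n v (i + 1) - zeroExt n v i) / hMid x i)

lemma zeroExt_zero (n : ℕ) (v : ℕ → ℝ) : zeroExt n v 0 = 0 := by simp [zeroExt]

lemma zeroExt_self (n : ℕ) (v : ℕ → ℝ) : zeroExt n v n = 0 := by simp [zeroExt]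

lemma zeroExt_of_mem {n i : ℕ} (v : ℕ → ℝ) (hi : i ∈ Ico 1 n) : zeroExt n v i = v i := by
  rw [mem_Ico] at hi
  rw [zeroExt, if_neg (by omega)]

lemma hMid_pos {x : ℕ → ℝ} {n i : ℕ} (hx : IsGrid x n) (hi : i < n) : 0 < hMid x i :=
  sub_pos.2 (hx.2.2 i hi)

lemma hNode_of_mem {x : ℕ → ℝ} {n i : ℕ} (hi : i ∈ Ico 1 n) :
    hNode x n i = midpt x i - midpt x (i - 1) := by
  rw [mem_Ico] at hi
  rw [hNode, if_neg (by omega), if_neg (by omega)]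

lemma hNode_pos {x : ℕ → ℝ} {n i : ℕ} (hx : IsGrid x n) (hi : i ∈ Ico 1 n) :
    0 < hNode x n i := by
  rw [hNode_of_mem hi]
  obtain ⟨h1, h2⟩ := mem_Ico.1 hi
  obtain ⟨k, rfl⟩ := Nat.exists_eq_add_of_le' h1
  have ha := hx.2.2 k (by omega)
  have hb := hx.2.2 (k + 1) h2
  simp only [midpt, Nat.add_sub_cancel]
  linarith

lemma sum_hNode_le_one {x : ℕ → ℝ} {n : ℕ} (hn : 1 ≤ n) (hx : IsGrid x n) :
    ∑ i ∈ Ico 1 n, hNode x n i ≤ 1 := by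
  obtain ⟨m, rfl⟩ := Nat.exists_eq_add_of_le' hn
  have h : ∑ i ∈ Ico 1 (m + 1), hNode x (m + 1) i = midpt x m - midpt x 0 := by
    rw [sum_congr rfl fun i hi => hNode_of_mem hi, sum_Ico_eq_sum_range,
      ← sum_range_sub]
    simp [add_comm]
  have ha := hx.2.2 0 (by omega)
  have hb := hx.2.2 m (by omega)
  have h0 := hx.1
  have h1 := hx.2.1
  rw [h, midpt, midpt]
  linarith

/-- Summation by parts for functions vanishing at both ends. -/
lemma sum_sub_mul_eq_neg_sum_mul_sub {n : ℕ} (hn : 1 ≤ n) (w u : ℕ → ℝ)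
    (h0 : u 0 = 0) (h1 : u n = 0) :
    ∑ i ∈ Ico 1 n, (w i - w (i - 1)) * u i = -∑ i ∈ range n, w i * (u (i + 1) - u i) := by
  obtain ⟨m, rfl⟩ := Nat.exists_eq_add_of_le' hn
  have h : ∀ m, ∑ i ∈ Ico 1 (m + 1), (w i - w (i - 1)) * u i
      = w m * u (m + 1) - w 0 * u 0 - ∑ i ∈ range (m + 1), w i * (u (i + 1) - u i) := by
    intro m
    induction m with
    | zero => simp; ring
    | succ k ih =>
      rw [sum_Ico_succ_top (by omega), ih, sum_range_succ _ (k + 1), Nat.add_sub_cancel]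
      ring
  rw [h, h0, h1]
  ring

lemma sum_diff_negDiff_mul {x : ℕ → ℝ} {n : ℕ} (hn : 1 ≤ n) (hx : IsGrid x n) (v : ℕ → ℝ) :
    ∑ i ∈ Ico 1 n,
        hNode x n i * ((negDiff x n v i - negDiff x n v (i - 1)) / hNode x n i) * v i
      = ∑ i ∈ range n, hMid x i * negDiff x n v i * negDiff x n v i := by
  have h : ∀ i ∈ Ico 1 n,
      hNode x n i * ((negDiff x n v i - negDiff x n v (i - 1)) / hNode x n i) * v i
        = (negDiff x n v i - negDiff x n v (i - 1)) * zeroExt n v i := fun i hi => by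
    rw [mul_div_cancel₀ _ (hNode_pos hx hi).ne', zeroExt_of_mem v hi]
  rw [sum_congr rfl h, sum_sub_mul_eq_neg_sum_mul_sub hn _ _ (zeroExt_zero n v)
    (zeroExt_self n v), ← sum_neg_distrib]
  refine sum_congr rfl fun i hi => ?_
  have := (hMid_pos hx (mem_range.1 hi)).ne'
  rw [negDiff]
  field_simp

lemma sq_le_sum_negDiff {x : ℕ → ℝ} {n i : ℕ} (hx : IsGrid x n) (v : ℕ → ℝ)
    (hi : i ∈ Ico 1 n) :
    v i * v i ≤ ∑ k ∈ range n, hMid x k * negDiff x n v k * negDiff x n v k := by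
  obtain ⟨h1, h2⟩ := mem_Ico.1 hi
  have hterm : ∀ k ∈ range n, hMid x k * negDiff x n v k * negDiff x n v k
      = (zeroExt n v (k + 1) - zeroExt n v k) ^ 2 / hMid x k := fun k hk => by
    have := (hMid_pos hx (mem_range.1 hk)).ne'
    rw [negDiff]
    field_simp
  have hpos : ∀ k ∈ range n, 0 < hMid x k := fun k hk => hMid_pos hx (mem_range.1 hk)
  have hsub : range i ⊆ range n := range_mono h2.le
  have hcs := sq_sum_div_le_sum_sq_div (range i)
    (fun k => zeroExt n v (k + 1) - zeroExt n v k) (g := hMid x) (fun k hk => hpos k (hsub hk))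
  have hsum : ∀ m, ∑ k ∈ range m, hMid x k = x m - x 0 := fun m => sum_range_sub x m
  have hxi : 0 < x i := by
    have := sum_pos (fun k hk => hpos k (hsub hk)) (nonempty_range_iff.2 (by omega : i ≠ 0))
    rwa [hsum, hx.1, sub_zero] at this
  have hxi1 : x i ≤ 1 := by
    have := sum_le_sum_of_subset_of_nonneg hsub fun k hk _ => (hpos k hk).le
    rwa [hsum, hsum, hx.1, hx.2.1, sub_zero, sub_zero] at this
  rw [sum_range_sub, zeroExt_zero, sub_zero, zeroExt_of_mem v hi, hsum, hx.1, sub_zero] at hcs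
  calc v i * v i = v i ^ 2 := by ring
    _ ≤ v i ^ 2 / x i := le_div_self (sq_nonneg _) hxi hxi1
    _ ≤ ∑ k ∈ range i, (zeroExt n v (k + 1) - zeroExt n v k) ^ 2 / hMid x k := hcs
    _ ≤ ∑ k ∈ range n, (zeroExt n v (k + 1) - zeroExt n v k) ^ 2 / hMid x k :=
      sum_le_sum_of_subset_of_nonneg hsub fun k hk _ =>
        div_nonneg (sq_nonneg _) (hpos k hk).le
    _ = _ := (sum_congr rfl hterm).symm

/-- Discrete Poincaré inequality on the unit interval, with constant `1`. -/
lemma sum_sq_le_sum_negDiff {x : ℕ → ℝ} {n : ℕ} (hn : 1 ≤ n) (hx : IsGrid x n) (v : ℕ → ℝ) :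
    ∑ i ∈ Ico 1 n, hNode x n i * v i * v i
      ≤ ∑ i ∈ range n, hMid x i * negDiff x n v i * negDiff x n v i := by
  set S := ∑ i ∈ range n, hMid x i * negDiff x n v i * negDiff x n v i with hS
  have hS0 : 0 ≤ S := sum_nonneg fun i hi => by
    rw [mul_assoc]
    exact mul_nonneg (hMid_pos hx (mem_range.1 hi)).le (mul_self_nonneg _)
  calc ∑ i ∈ Ico 1 n, hNode x n i * v i * v i ≤ ∑ i ∈ Ico 1 n, hNode x n i * S :=
        sum_le_sum fun i hi => by
          rw [mul_assoc]
          exact mul_le_mul_of_nonneg_left (sq_le_sum_negDiff hx v hi) (hNode_pos hx hi).le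
    _ = (∑ i ∈ Ico 1 n, hNode x n i) * S := (sum_mul _ _ _).symm
    _ ≤ S := mul_le_of_le_one_left hS0 (sum_hNode_le_one hn hx)

lemma eq_zero_of_negDiff_eq_zero {x : ℕ → ℝ} {n i : ℕ} (hx : IsGrid x n) (v : ℕ → ℝ)
    (h : ∀ k ∈ range n, negDiff x n v k = 0) (hi : i ∈ Ico 1 n) : v i = 0 := by
  have hle := sq_le_sum_negDiff hx v hi
  rw [sum_eq_zero fun k hk => by rw [h k hk, mul_zero]] at hle
  exact mul_self_eq_zero.1 (le_antisymm hle (mul_self_nonneg _))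

section Grid

variable {x y : ℕ → ℝ} {nx ny : ℕ}

lemma ipM_comm_grid (φ θ : ℕ → ℕ → ℝ) :
    ipM x y nx ny φ θ = ipM y x ny nx (fun j i => φ i j) (fun j i => θ i j) := by
  rw [ipM, sum_comm]
  simp only [ipM, mul_comm (hMid x _)]

lemma ipMT_eq_ipTM (φ θ : ℕ → ℕ → ℝ) :
    ipMT x y nx ny φ θ = ipTM y x ny nx (fun j i => φ i j) (fun j i => θ i j) := by
  rw [ipMT, sum_comm]
  simp only [ipTM, mul_comm (hMid x _)]

lemma ipM_eq_sum_mul (φ θ : ℕ → ℕ → ℝ) :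
    ipM x y nx ny φ θ
      = ∑ j ∈ range ny, hMid y j * ∑ i ∈ range nx, hMid x i * φ i j * θ i j := by
  rw [ipM, sum_comm]
  exact sum_congr rfl fun j _ => by
    rw [mul_sum]
    exact sum_congr rfl fun i _ => by ring

lemma ipTM_eq_sum_mul (φ θ : ℕ → ℕ → ℝ) :
    ipTM x y nx ny φ θ
      = ∑ j ∈ range ny, hMid y j * ∑ i ∈ Ico 1 nx, hNode x nx i * φ i j * θ i j := by
  rw [ipTM, sum_comm]
  exact sum_congr rfl fun j _ => by
    rw [mul_sum]
    exact sum_congr rfl fun i _ => by ring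

lemma ipTM_diff_negDiff (hnx : 1 ≤ nx) (hx : IsGrid x nx) (v : ℕ → ℕ → ℝ) :
    ipTM x y nx ny (fun i j => (negDiff x nx (v · j) i - negDiff x nx (v · j) (i - 1))
        / hNode x nx i) v
      = ipM x y nx ny (fun i j => negDiff x nx (v · j) i) (fun i j => negDiff x nx (v · j) i) := by
  rw [ipTM_eq_sum_mul, ipM_eq_sum_mul]
  exact sum_congr rfl fun j _ => by rw [sum_diff_negDiff_mul hnx hx (v · j)]

lemma ipTM_self_le_ipM_negDiff (hnx : 1 ≤ nx) (hx : IsGrid x nx) (hy : IsGrid y ny)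
    (v : ℕ → ℕ → ℝ) :
    ipTM x y nx ny v v
      ≤ ipM x y nx ny (fun i j => negDiff x nx (v · j) i) (fun i j => negDiff x nx (v · j) i) := by
  rw [ipTM_eq_sum_mul, ipM_eq_sum_mul]
  exact sum_le_sum fun j hj => mul_le_mul_of_nonneg_left
    (sum_sq_le_sum_negDiff hnx hx (v · j)) (hMid_pos hy (mem_range.1 hj)).le

lemma ipM_self_nonneg (hx : IsGrid x nx) (hy : IsGrid y ny) (φ : ℕ → ℕ → ℝ) :
    0 ≤ ipM x y nx ny φ φ :=
  sum_nonneg fun i hi => sum_nonneg fun j hj => by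
    rw [mul_assoc]
    exact mul_nonneg (mul_pos (hMid_pos hx (mem_range.1 hi)) (hMid_pos hy (mem_range.1 hj))).le
      (mul_self_nonneg _)

end Grid

/-- Discrete LBB (inf-sup) condition for the MAC-E scheme with constant `β = 1`:
for every pair of discrete displacement functions `vx, vy`, not both identically
zero, there exist discrete stresses `τ¹¹, τ²², τ¹²`, not all identically zero, with
`(D_x τ¹¹ + d_y τ¹², vx)_{TM} + (d_x τ¹² + D_y τ²², vy)_{MT} ≥ ‖τ‖ ‖v‖`. -/
theorem mac_discrete_LBB
    (nx ny : ℕ) (hnx : 2 ≤ nx) (hny : 2 ≤ ny)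
    (x y : ℕ → ℝ) (hx : IsGrid x nx) (hy : IsGrid y ny)
    (vx vy : ℕ → ℕ → ℝ)
    (hv : ¬ ((∀ i ∈ Ico 1 nx, ∀ j ∈ range ny, vx i j = 0) ∧
             (∀ i ∈ range nx, ∀ j ∈ Ico 1 ny, vy i j = 0))) :
    ∃ t11 t22 t12 : ℕ → ℕ → ℝ,
      ¬ ((∀ i ∈ range nx, ∀ j ∈ range ny, t11 i j = 0) ∧
         (∀ i ∈ range nx, ∀ j ∈ range ny, t22 i j = 0) ∧
         (∀ i ∈ range (nx + 1), ∀ j ∈ range (ny + 1), t12 i j = 0)) ∧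
      ipTM x y nx ny
          (fun i j => (t11 i j - t11 (i - 1) j) / hNode x nx i
            + (t12 i (j + 1) - t12 i j) / hMid y j) vx
        + ipMT x y nx ny
          (fun i j => (t12 (i + 1) j - t12 i j) / hMid x i
            + (t22 i j - t22 i (j - 1)) / hNode y ny j) vy
      ≥ Real.sqrt (ipM x y nx ny t11 t11 + ipM x y nx ny t22 t22
            + ipT x y nx ny t12 t12)
        * Real.sqrt (ipTM x y nx ny vx vx + ipMT x y nx ny vy vy) := by
  have hnx1 : 1 ≤ nx := by omega
  have hny1 : 1 ≤ ny := by omega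
  refine ⟨fun i j => negDiff x nx (vx · j) i, fun i j => negDiff y ny (vy i) j, fun _ _ => 0,
    ?_, ?_⟩
  · rintro ⟨h1, h2, -⟩
    exact hv ⟨fun i hi j hj => eq_zero_of_negDiff_eq_zero hx (vx · j) (fun k hk => h1 k hk j hj) hi,
      fun i hi j hj => eq_zero_of_negDiff_eq_zero hy (vy i) (h2 i hi) hj⟩
  · have hT : ipT x y nx ny (fun _ _ => 0) (fun _ _ => 0) = 0 := by simp [ipT]
    simp only [sub_self, zero_div, add_zero, zero_add, hT]
    rw [ipTM_diff_negDiff hnx1 hx vx, ipMT_eq_ipTM, ipMT_eq_ipTM,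
      ipTM_diff_negDiff hny1 hy (fun j i => vy i j),
      ipM_comm_grid (fun i j => negDiff y ny (vy i) j)]
    have hle := add_le_add (ipTM_self_le_ipM_negDiff hnx1 hx hy vx)
      (ipTM_self_le_ipM_negDiff hny1 hy hx (fun j i => vy i j))
    have hnn := add_nonneg
      (ipM_self_nonneg hx hy fun i j => negDiff x nx (vx · j) i)
      (ipM_self_nonneg hy hx fun j i => negDiff y ny (vy i) j)
    exact (mul_le_mul_of_nonneg_left (Real.sqrt_le_sqrt hle) (Real.sqrt_nonneg _)).trans_eq
      (Real.mul_self_sqrt hnn)
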